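/- arXiv:2505.00370 — 5 statements merged into one kernel-verified Lean document; each statement's English description precedes it below -/
import Mathlib

section
/- Let Q_k be the polynomials defined by Q_0(p) = 1 and Q_{k+1}(p) = (1 - p^2)^2 Q_k'(p) + 2p(2k - 1 - 2k p^2) Q_k(p). Then for every k ≥ 1: (i) the degree of Q_k is at most 3k; (ii) every coefficient of Q_k has absolute value at most 2 · 20^{k-1} · (k-1)!; and consequently (iii) |Q_k(p)| ≤ 20^k · k! for every real p with |p| ≤ 1. -/
open Polynomial

/-- The polynomials `Q k` defined by `Q 0 = 1` and
`Q (k+1) (p) = (1 - p^2)^2 * Q k' (p) + 2p(2k - 1 - 2k p^2) Q k (p)`. -/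
noncomputable def Q : ℕ → Polynomial ℝ
  | 0 => 1
  | (k + 1) =>
      (1 - X ^ 2) ^ 2 * derivative (Q k) +
        C 2 * X * (C (2 * (k : ℝ) - 1) - C (2 * (k : ℝ)) * X ^ 2) * Q k

theorem Q_succ_expand (k : ℕ) :
    Q (k + 1) = derivative (Q k) - C 2 * (derivative (Q k) * X ^ 2) + derivative (Q k) * X ^ 4 +
      C (4 * (k : ℝ) - 2) * (Q k * X ^ 1) - C (4 * (k : ℝ)) * (Q k * X ^ 3) := by
  simp only [Q, map_sub, map_mul, map_one, C_ofNat]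
  ring

theorem Q_succ_coeff_zero (k : ℕ) : (Q (k + 1)).coeff 0 = (Q k).coeff 1 := by
  rw [Q_succ_expand]
  simp [coeff_derivative]

theorem Q_succ_coeff_one (k : ℕ) :
    (Q (k + 1)).coeff 1 = 2 * (Q k).coeff 2 + (4 * (k : ℝ) - 2) * (Q k).coeff 0 := by
  rw [Q_succ_expand]
  simp only [coeff_add, coeff_sub, coeff_C_mul, coeff_mul_X_pow', coeff_derivative]
  norm_num
  ring

theorem Q_succ_coeff_two (k : ℕ) :
    (Q (k + 1)).coeff 2 = 3 * (Q k).coeff 3 + (4 * (k : ℝ) - 2 - 2 * 1) * (Q k).coeff 1 := by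
  rw [Q_succ_expand]
  simp only [coeff_add, coeff_sub, coeff_C_mul, coeff_mul_X_pow', coeff_derivative]
  norm_num
  ring

theorem Q_succ_coeff_add_three (k n : ℕ) :
    (Q (k + 1)).coeff (n + 3) = ((n : ℝ) + 4) * (Q k).coeff (n + 4) +
      (4 * (k : ℝ) - 2 - 2 * ((n : ℝ) + 2)) * (Q k).coeff (n + 2) +
      ((n : ℝ) - 4 * k) * (Q k).coeff n := by
  rw [Q_succ_expand]
  simp only [coeff_add, coeff_sub, coeff_C_mul, coeff_mul_X_pow', coeff_derivative]
  cases n with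
  | zero => norm_num; ring
  | succ m =>
    simp only [show m + 1 + 3 = m + 4 by rfl, show 2 ≤ m + 4 by omega, show 4 ≤ m + 4 by omega,
      show 1 ≤ m + 4 by omega, show 3 ≤ m + 4 by omega, if_true,
      show m + 4 - 2 = m + 2 by omega, show m + 4 - 4 = m by omega,
      show m + 4 - 1 = m + 3 by omega, show m + 4 - 3 = m + 1 by omega]
    push_cast
    ring_nf

theorem natDegree_Q_le (k : ℕ) : (Q k).natDegree ≤ 3 * k := by
  induction k with
  | zero => simp [Q]
  | succ k ih =>
    rw [natDegree_le_iff_coeff_eq_zero]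
    intro j hj
    obtain ⟨n, rfl⟩ : ∃ n, j = n + 3 := ⟨j - 3, by omega⟩
    have h (i : ℕ) (hi : 3 * k < i) : (Q k).coeff i = 0 :=
      coeff_eq_zero_of_natDegree_lt (ih.trans_lt hi)
    rw [Q_succ_coeff_add_three, h _ (by omega), h _ (by omega), h _ (by omega)]
    ring

theorem abs_mul_coeff_Q_le {k i : ℕ} {A t s : ℝ} (hA : ∀ j, |(Q k).coeff j| ≤ A)
    (hs : 0 ≤ s) (ht : i ≤ 3 * k → |t| ≤ s) : |t * (Q k).coeff i| ≤ s * A := by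
  by_cases hi : i ≤ 3 * k
  · rw [abs_mul]
    exact mul_le_mul (ht hi) (hA i) (abs_nonneg _) hs
  · rw [coeff_eq_zero_of_natDegree_lt ((natDegree_Q_le k).trans_lt (not_le.mp hi))]
    simpa using mul_nonneg hs ((abs_nonneg _).trans (hA 0))

theorem abs_coeff_Q_succ_le {k : ℕ} (hk : 1 ≤ k) {A : ℝ} (hA : ∀ j, |(Q k).coeff j| ≤ A)
    (j : ℕ) : |(Q (k + 1)).coeff j| ≤ 20 * k * A := by
  have hk' : (1 : ℝ) ≤ k := by exact_mod_cast hk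
  have hA0 : 0 ≤ A := (abs_nonneg _).trans (hA 0)
  have hkA : A ≤ k * A := le_mul_of_one_le_left hA0 hk'
  have mid (i : ℕ) : |(4 * (k : ℝ) - 2 - 2 * i) * (Q k).coeff i| ≤ 4 * k * A := by
    refine abs_mul_coeff_Q_le hA (by positivity) fun hi => ?_
    have hi' : (i : ℝ) ≤ 3 * k := by exact_mod_cast hi
    have hi0 : (0 : ℝ) ≤ i := by positivity
    rw [abs_le]
    constructor <;> linarith
  have up (i : ℕ) : |(i : ℝ) * (Q k).coeff i| ≤ 3 * k * A := by
    refine abs_mul_coeff_Q_le hA (by positivity) fun hi => ?_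
    rw [Nat.abs_cast]
    exact_mod_cast hi
  have low (i : ℕ) : |((i : ℝ) - 4 * k) * (Q k).coeff i| ≤ 4 * k * A := by
    refine abs_mul_coeff_Q_le hA (by positivity) fun hi => ?_
    have hi' : (i : ℝ) ≤ 3 * k := by exact_mod_cast hi
    have hi0 : (0 : ℝ) ≤ i := by positivity
    rw [abs_le]
    constructor <;> linarith
  match j with
  | 0 =>
    rw [Q_succ_coeff_zero]
    linarith [hA 1]
  | 1 =>
    have h1 := up 2
    have h2 := mid 0
    push_cast at h1 h2
    rw [mul_zero, sub_zero] at h2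
    rw [Q_succ_coeff_one]
    exact (abs_add_le _ _).trans (by linarith)
  | 2 =>
    have h1 := up 3
    have h2 := mid 1
    push_cast at h1 h2
    rw [Q_succ_coeff_two]
    exact (abs_add_le _ _).trans (by linarith)
  | n + 3 =>
    have h1 := up (n + 4)
    have h2 := mid (n + 2)
    push_cast at h1 h2
    rw [Q_succ_coeff_add_three]
    exact (abs_add_three _ _ _).trans (by linarith [low n])

theorem abs_coeff_Q_le (k j : ℕ) :
    |(Q (k + 1)).coeff j| ≤ 2 * 20 ^ k * (Nat.factorial k : ℝ) := by
  induction k generalizing j with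
  | zero =>
    have h : Q (0 + 1) = C (-2) * X := by
      simp [Q]
    rw [h, coeff_C_mul, coeff_X]
    split_ifs <;> norm_num
  | succ k ih =>
    refine (abs_coeff_Q_succ_le (Nat.le_add_left 1 k) ih j).trans_eq ?_
    rw [Nat.factorial_succ]
    push_cast
    ring

theorem abs_eval_le_of_abs_coeff_le {P : ℝ[X]} {d : ℕ} {A p : ℝ} (hd : P.natDegree ≤ d)
    (hA : ∀ j, |P.coeff j| ≤ A) (hp : |p| ≤ 1) : |P.eval p| ≤ (d + 1) * A := by
  rw [eval_eq_sum_range' (Nat.lt_succ_of_le hd)]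
  refine (Finset.abs_sum_le_sum_abs _ _).trans ?_
  refine (Finset.sum_le_card_nsmul _ _ A fun i _ => ?_).trans_eq (by simp)
  rw [abs_mul, abs_pow]
  exact (mul_le_of_le_one_right (abs_nonneg _) (pow_le_one₀ (abs_nonneg _) hp)).trans (hA i)

theorem stmt1 (k : ℕ) (hk : 1 ≤ k) :
    (Q k).natDegree ≤ 3 * k ∧
    (∀ j : ℕ, |(Q k).coeff j| ≤ 2 * 20 ^ (k - 1) * ((Nat.factorial (k - 1)) : ℝ)) ∧
    (∀ p : ℝ, |p| ≤ 1 → |(Q k).eval p| ≤ 20 ^ k * (Nat.factorial k : ℝ)) := by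
  obtain ⟨k, rfl⟩ : ∃ m, k = m + 1 := ⟨k - 1, by omega⟩
  refine ⟨natDegree_Q_le _, abs_coeff_Q_le k, fun p hp => ?_⟩
  refine (abs_eval_le_of_abs_coeff_le (natDegree_Q_le _) (abs_coeff_Q_le k) hp).trans ?_
  rw [Nat.factorial_succ, pow_succ]
  push_cast
  have h : (0 : ℝ) ≤ 20 ^ k * (Nat.factorial k : ℝ) := by positivity
  have hk0 : (0 : ℝ) ≤ k := by positivity
  nlinarith [mul_nonneg h hk0]
end

section
/- Let θ : ℝ → ℝ be defined by θ(p) = exp(1/(p^2 - 1)) for |p| < 1 and θ(p) = 0 for |p| ≥ 1. Then θ is infinitely differentiable on ℝ, and for every integer k ≥ 1 and every p ∈ ℝ, the k-th derivative satisfies |θ^{(k)}(p)| ≤ 20^k · k! · e^{-2k} · (2k)^{2k}. -/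
/-- The (unnormalized) mollifier `θ(p) = exp(1/(p² - 1))` for `|p| < 1`, `0` otherwise. -/
noncomputable def θ (p : ℝ) : ℝ := if |p| < 1 then Real.exp (1 / (p ^ 2 - 1)) else 0

open Filter Topology in
/-- Real and complex iterated derivatives agree, on the trace of an open set, for a function that
is the real part of an analytic one. -/
theorem iteratedDeriv_eq_re_of_analyticOnNhd {f : ℂ → ℂ} {U : Set ℂ} {g : ℝ → ℝ}
    {V : Set ℝ} (hf : AnalyticOnNhd ℂ f U) (hV : IsOpen V) (hVU : ∀ x ∈ V, (x : ℂ) ∈ U)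
    (hg : ∀ x ∈ V, g x = (f x).re) (n : ℕ) :
    ∀ x ∈ V, iteratedDeriv n g x = (iteratedDeriv n f x).re := by
  induction n with
  | zero => simpa using hg
  | succ n ih =>
    intro x hx
    have hEq : iteratedDeriv n g =ᶠ[𝓝 x] fun y : ℝ => (iteratedDeriv n f y).re := by
      filter_upwards [hV.mem_nhds hx] with y hy using ih y hy
    have hA : AnalyticAt ℂ (iteratedDeriv n f) x := by
      rw [iteratedDeriv_eq_iterate]
      exact hf.iterated_deriv n x (hVU x hx)
    rw [iteratedDeriv_succ, iteratedDeriv_succ, hEq.deriv_eq]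
    exact hA.differentiableAt.hasDerivAt.real_of_complex.deriv

theorem θ_eq_expNegInvGlue (p : ℝ) : θ p = expNegInvGlue (1 - p ^ 2) := by
  unfold θ expNegInvGlue
  have h : |p| < 1 ↔ ¬ 1 - p ^ 2 ≤ 0 := by
    rw [← sq_lt_one_iff_abs_lt_one, not_le, sub_pos]
  by_cases hp : |p| < 1
  · rw [if_pos hp, if_neg (h.1 hp), one_div, ← inv_neg, neg_sub]
  · rw [if_neg hp, if_pos (not_not.1 (mt h.2 hp))]

theorem contDiff_θ : ContDiff ℝ (⊤ : ℕ∞) θ := by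
  rw [funext θ_eq_expNegInvGlue]
  exact expNegInvGlue.contDiff.comp (by fun_prop)

/-- The holomorphic extension of `θ` off the points `±1`. -/
noncomputable def θExt (z : ℂ) : ℂ := Complex.exp (-((1 - z)⁻¹ + (1 + z)⁻¹) / 2)

theorem θExt_neg (z : ℂ) : θExt (-z) = θExt z := by
  rw [θExt, θExt, sub_neg_eq_add, ← sub_eq_add_neg, add_comm (1 + z)⁻¹]

theorem θ_eq_re_θExt {p : ℝ} (hp : |p| < 1) : θ p = (θExt p).re := by
  obtain ⟨h1, h2⟩ := abs_lt.1 hp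
  have h : 1 / (p ^ 2 - 1) = -((1 - p)⁻¹ + (1 + p)⁻¹) / 2 := by
    have : 1 - p ≠ 0 := by linarith
    have : 1 + p ≠ 0 := by linarith
    have : p ^ 2 - 1 ≠ 0 := by nlinarith
    field_simp
    ring
  rw [θ, if_pos hp, h, θExt, ← Complex.exp_ofReal_re]
  push_cast
  rfl

theorem analyticOnNhd_θExt : AnalyticOnNhd ℂ θExt {z | 1 - z ≠ 0 ∧ 1 + z ≠ 0} := by
  rintro z ⟨h1, h2⟩
  unfold θExt
  fun_prop (disch := assumption)

theorem norm_θExt_le_of_nonneg {p : ℝ} {z : ℂ} (h0 : 0 ≤ p) (h1 : p < 1)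
    (hz : ‖z - p‖ ≤ (1 - p) / 2) :
    ‖θExt z‖ ≤ Real.exp (-(1 / (3 * (1 - p)))) := by
  have hd : 0 < 1 - p := by linarith
  have hre := abs_le.1 ((Complex.abs_re_le_norm _).trans hz)
  simp only [Complex.sub_re, Complex.ofReal_re] at hre
  have hsq : (z.re - p) ^ 2 + z.im ^ 2 ≤ ((1 - p) / 2) ^ 2 := by
    have := pow_le_pow_left₀ (norm_nonneg _) hz 2
    rw [Complex.sq_norm, Complex.normSq_apply] at this
    simp only [Complex.sub_re, Complex.ofReal_re, Complex.sub_im, Complex.ofReal_im] at this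
    linarith
  have hplus : 0 ≤ ((1 + z)⁻¹).re := by
    rw [Complex.inv_re]
    refine div_nonneg ?_ (Complex.normSq_nonneg _)
    simp only [Complex.add_re, Complex.one_re]
    linarith
  have hminus : 2 / (3 * (1 - p)) ≤ ((1 - z)⁻¹).re := by
    rw [Complex.inv_re, Complex.normSq_apply]
    simp only [Complex.sub_re, Complex.one_re, Complex.sub_im, Complex.one_im]
    rw [div_le_div_iff₀ (by linarith) (by nlinarith)]
    nlinarith
  rw [θExt, Complex.norm_exp, Real.exp_le_exp]
  have hhalf : (-((1 - z)⁻¹ + (1 + z)⁻¹) / 2).re = -(((1 - z)⁻¹).re + ((1 + z)⁻¹).re) / 2 := by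
    rw [← Complex.ofReal_ofNat, Complex.div_ofReal_re, Complex.neg_re, Complex.add_re]
  have : 2 / (3 * (1 - p)) = 2 * (1 / (3 * (1 - p))) := by ring
  rw [hhalf]
  linarith

theorem norm_θExt_le {p : ℝ} {z : ℂ} (hp : |p| < 1) (hz : ‖z - p‖ ≤ (1 - |p|) / 2) :
    ‖θExt z‖ ≤ Real.exp (-(1 / (3 * (1 - |p|)))) := by
  rcases le_total 0 p with h0 | h0
  · rw [abs_of_nonneg h0] at *
    exact norm_θExt_le_of_nonneg h0 hp hz
  · rw [abs_of_nonpos h0] at *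
    rw [← θExt_neg]
    refine norm_θExt_le_of_nonneg (by linarith) hp ?_
    rwa [Complex.ofReal_neg, ← neg_sub', norm_neg]

open Metric in
theorem abs_iteratedDeriv_θ_le_of_abs_lt {p : ℝ} (hp : |p| < 1) (k : ℕ) :
    |iteratedDeriv k θ p| ≤
      k.factorial * Real.exp (-(1 / (3 * (1 - |p|)))) / ((1 - |p|) / 2) ^ k := by
  have hd : 0 < 1 - |p| := by linarith
  have hsub : closedBall (p : ℂ) ((1 - |p|) / 2) ⊆ {z | 1 - z ≠ 0 ∧ 1 + z ≠ 0} := by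
    intro z hz
    have hz := abs_le.1 ((Complex.abs_re_le_norm _).trans (mem_closedBall_iff_norm.1 hz))
    simp only [Complex.sub_re, Complex.ofReal_re] at hz
    have := neg_abs_le p
    have := le_abs_self p
    constructor
    · intro h
      have := congrArg Complex.re h
      simp only [Complex.sub_re, Complex.one_re, Complex.zero_re] at this
      linarith
    · intro h
      have := congrArg Complex.re h
      simp only [Complex.add_re, Complex.one_re, Complex.zero_re] at this
      linarith
  have hre : iteratedDeriv k θ p = (iteratedDeriv k θExt p).re := by
    refine iteratedDeriv_eq_re_of_analyticOnNhd (V := {x | |x| < 1}) analyticOnNhd_θExt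
      (isOpen_lt continuous_abs continuous_const) (fun x hx => ?_)
      (fun x hx => θ_eq_re_θExt hx) k p hp
    obtain ⟨h1, h2⟩ := abs_lt.1 (Set.mem_ofPred.1 hx)
    constructor
    · exact_mod_cast (by linarith : 1 - x ≠ 0)
    · exact_mod_cast (by linarith : 1 + x ≠ 0)
  rw [hre]
  refine (Complex.abs_re_le_norm _).trans ?_
  refine Complex.norm_iteratedDeriv_le_of_forall_mem_sphere_norm_le k (by linarith) ?_
    fun z hz => norm_θExt_le hp (mem_sphere_iff_norm.1 hz).le
  exact (analyticOnNhd_θExt.differentiableOn.mono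
    ((closure_ball_subset_closedBall).trans hsub)).diffContOnCl

theorem exp_div_pow_le {d : ℝ} (hd : 0 < d) {k : ℕ} (hk : 1 ≤ k) :
    Real.exp (-(1 / (3 * d))) / (d / 2) ^ k ≤
      20 ^ k * Real.exp (-(2 * (k : ℝ))) * (2 * (k : ℝ)) ^ (2 * k) := by
  have hk' : (1 : ℝ) ≤ k := by exact_mod_cast hk
  have hk0 : (k : ℝ) ≠ 0 := by positivity
  set t : ℝ := 1 / (3 * d * k) with ht
  have h2d : (d / 2)⁻¹ = 6 * k * t := by
    rw [ht]
    field_simp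
    norm_num
  have hexp : Real.exp (-(1 / (3 * d))) = Real.exp (-t) ^ k := by
    rw [← Real.exp_nat_mul, ht]
    congr 1
    field_simp
  have hexp2 : Real.exp (-(2 * (k : ℝ))) = Real.exp (-2) ^ k := by
    rw [← Real.exp_nat_mul]
    congr 1
    ring
  rw [div_eq_mul_inv, ← inv_pow, h2d, hexp, hexp2, pow_mul, ← mul_pow, ← mul_pow, ← mul_pow]
  have ht0 : 0 ≤ t := by positivity
  refine pow_le_pow_left₀ (by positivity) ?_ k
  have h1 : t * Real.exp (-t) ≤ 3 * Real.exp (-2) := by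
    have hle : t ≤ Real.exp (t - 1) := by linarith [Real.add_one_le_exp (t - 1)]
    calc t * Real.exp (-t) ≤ Real.exp (t - 1) * Real.exp (-t) := by gcongr
      _ = Real.exp 1 * Real.exp (-2) := by
        rw [← Real.exp_add, ← Real.exp_add]
        congr 1
        ring
      _ ≤ 3 * Real.exp (-2) := by
        gcongr
        exact Real.exp_one_lt_three.le
  calc Real.exp (-t) * (6 * k * t) = 6 * k * (t * Real.exp (-t)) := by ring
    _ ≤ 6 * k * (3 * Real.exp (-2)) := by gcongr
    _ = (18 * k) * Real.exp (-2) := by ring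
    _ ≤ (20 * (2 * k) ^ 2) * Real.exp (-2) := by
      gcongr ?_ * _
      nlinarith
    _ = 20 * Real.exp (-2) * (2 * k) ^ 2 := by ring

open Filter Topology in
theorem iteratedDeriv_θ_eq_zero {p : ℝ} (hp : 1 < |p|) (k : ℕ) : iteratedDeriv k θ p = 0 := by
  have h : θ =ᶠ[𝓝 p] fun _ => 0 := by
    filter_upwards [(isOpen_lt continuous_const continuous_abs).mem_nhds hp] with x hx
    exact if_neg (not_lt.2 (le_of_lt hx))
  rw [h.iteratedDeriv_eq, iteratedDeriv_const]
  simp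

theorem stmt2 :
    ContDiff ℝ (⊤ : ℕ∞) θ ∧
    ∀ k : ℕ, 1 ≤ k → ∀ p : ℝ,
      |iteratedDeriv k θ p| ≤
        20 ^ k * (Nat.factorial k : ℝ) * Real.exp (-(2 * (k : ℝ))) * (2 * (k : ℝ)) ^ (2 * k) := by
  refine ⟨contDiff_θ, fun k hk p => ?_⟩
  have hclosed : IsClosed {p : ℝ | |iteratedDeriv k θ p| ≤
      20 ^ k * (Nat.factorial k : ℝ) * Real.exp (-(2 * (k : ℝ))) * (2 * (k : ℝ)) ^ (2 * k)} :=
    isClosed_le (contDiff_θ.continuous_iteratedDeriv k (by exact_mod_cast le_top)).abs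
      continuous_const
  have hdense : Dense ({1, -1}ᶜ : Set ℝ) := (Set.toFinite _).countable.dense_compl ℝ
  refine hclosed.closure_subset_iff.2 (fun x hx => ?_) (hdense p)
  have hx1 : |x| ≠ 1 := fun h => hx (eq_or_eq_neg_of_abs_eq h)
  rcases lt_or_gt_of_ne hx1 with h | h
  · refine (abs_iteratedDeriv_θ_le_of_abs_lt h k).trans ?_
    have := mul_le_mul_of_nonneg_left (exp_div_pow_le (sub_pos.2 h) hk)
      (Nat.cast_nonneg (α := ℝ) k.factorial)
    calc _ = _ := mul_div_assoc _ _ _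
      _ ≤ _ := this
      _ = _ := by ring
  · rw [Set.mem_ofPred_eq, iteratedDeriv_θ_eq_zero h, abs_zero]
    positivity
end

section
/- Let η : ℝ → ℝ be the standard mollifier, η(p) = C^{-1} exp(1/(p^2 - 1)) for |p| < 1 and η(p) = 0 for |p| ≥ 1, with C = ∫_{-1}^{1} exp(1/(p^2-1)) dp. For d > 0 let η_d(p) = d^{-1} η(p/d), let χ be the indicator function of a bounded interval Ω₁ ⊂ ℝ, and define ζ(p) = ∫_ℝ η_d(p - y) χ(y) dy. Then ζ is infinitely differentiable, 0 ≤ ζ(p) ≤ 1 for all p, and for every integer k ≥ 1 and all p ∈ ℝ, |ζ^{(k)}(p)| ≤ (2/C) · 20^k · k! · e^{-2k} · (2k)^{2k} / d^k. -/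
/-- The normalization constant `C = ∫_{-1}^{1} exp(1/(p²-1)) dp` of the standard mollifier. -/
noncomputable def mollC : ℝ := ∫ p in (-1 : ℝ)..1, Real.exp (1 / (p ^ 2 - 1))

/-- The standard mollifier `η(p) = C⁻¹ exp(1/(p² - 1))` for `|p| < 1`, `0` otherwise. -/
noncomputable def η (p : ℝ) : ℝ :=
  if |p| < 1 then mollC⁻¹ * Real.exp (1 / (p ^ 2 - 1)) else 0

/-- The sum of the absolute values of the coefficients of a real polynomial. -/
noncomputable def Polynomial.coeffL1 (P : Polynomial ℝ) : ℝ := P.sum fun _ c => |c|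

namespace Polynomial

theorem coeffL1_eq_sum_of_support_subset {P : Polynomial ℝ} {s : Finset ℕ} (h : P.support ⊆ s) :
    P.coeffL1 = ∑ i ∈ s, |P.coeff i| :=
  sum_eq_of_subset (fun _ c => |c|) (by simp) h

theorem coeffL1_nonneg (P : Polynomial ℝ) : 0 ≤ P.coeffL1 :=
  Finset.sum_nonneg fun _ _ => abs_nonneg _

theorem coeffL1_add_le (P Q : Polynomial ℝ) : (P + Q).coeffL1 ≤ P.coeffL1 + Q.coeffL1 := by
  rw [coeffL1_eq_sum_of_support_subset (Polynomial.support_add (p := P) (q := Q)),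
    coeffL1_eq_sum_of_support_subset (P := P) (s := P.support ∪ Q.support)
      Finset.subset_union_left,
    coeffL1_eq_sum_of_support_subset (P := Q) (s := P.support ∪ Q.support)
      Finset.subset_union_right, ← Finset.sum_add_distrib]
  exact Finset.sum_le_sum fun i _ => by rw [coeff_add]; exact abs_add_le _ _

@[simp]
theorem coeffL1_zero : (0 : Polynomial ℝ).coeffL1 = 0 := by simp [coeffL1]

@[simp]
theorem coeffL1_monomial (n : ℕ) (c : ℝ) : (monomial n c).coeffL1 = |c| :=
  sum_monomial_index c _ (by simp)

theorem coeffL1_sum_le {ι : Type*} (s : Finset ι) (f : ι → Polynomial ℝ) :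
    (∑ i ∈ s, f i).coeffL1 ≤ ∑ i ∈ s, (f i).coeffL1 := by
  classical
  induction s using Finset.induction_on with
  | empty => simp
  | insert i s hi ih =>
    rw [Finset.sum_insert hi, Finset.sum_insert hi]
    exact (coeffL1_add_le _ _).trans (by gcongr)

theorem coeffL1_mul_le (P Q : Polynomial ℝ) : (P * Q).coeffL1 ≤ P.coeffL1 * Q.coeffL1 := by
  rw [mul_eq_sum_sum]
  refine (coeffL1_sum_le _ _).trans ?_
  unfold coeffL1 Polynomial.sum
  rw [Finset.sum_mul]
  refine Finset.sum_le_sum fun i _ => (coeffL1_sum_le _ _).trans ?_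
  rw [Finset.mul_sum]
  exact Finset.sum_le_sum fun j _ => by rw [coeffL1_monomial, abs_mul]

theorem coeffL1_derivative_le (P : Polynomial ℝ) :
    (derivative P).coeffL1 ≤ P.natDegree * P.coeffL1 := by
  rw [derivative_apply]
  refine (coeffL1_sum_le _ _).trans ?_
  unfold coeffL1
  rw [Polynomial.sum, Finset.mul_sum]
  refine Finset.sum_le_sum fun i hi => ?_
  have h := coeffL1_monomial (i - 1) (P.coeff i * i)
  unfold coeffL1 at h
  beta_reduce
  rw [C_mul_X_pow_eq_monomial, h, abs_mul, Nat.abs_cast, mul_comm]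
  gcongr
  exact le_natDegree_of_mem_supp i hi

theorem abs_eval_le_coeffL1 (P : Polynomial ℝ) {x : ℝ} (hx : |x| ≤ 1) :
    |P.eval x| ≤ P.coeffL1 := by
  rw [eval_eq_sum]
  refine (Finset.abs_sum_le_sum_abs _ _).trans (Finset.sum_le_sum fun i _ => ?_)
  rw [abs_mul, abs_pow]
  exact mul_le_of_le_one_right (abs_nonneg _) (pow_le_one₀ (abs_nonneg _) hx)

end Polynomial

/-- The function `x ↦ x⁻ᵏ exp (-1/x)` on `x > 0`, extended by zero. -/
noncomputable def invPowGlue (k : ℕ) (x : ℝ) : ℝ := x⁻¹ ^ k * expNegInvGlue x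

theorem mul_invPowGlue_succ (k : ℕ) (x : ℝ) : x * invPowGlue (k + 1) x = invPowGlue k x := by
  unfold invPowGlue
  rcases eq_or_ne x 0 with rfl | hx
  · simp
  · rw [pow_succ]; field_simp

theorem hasDerivAt_invPowGlue (k : ℕ) (x : ℝ) :
    HasDerivAt (invPowGlue k) (invPowGlue (k + 2) x - k * invPowGlue (k + 1) x) x := by
  have h := expNegInvGlue.hasDerivAt_polynomial_eval_inv_mul (Polynomial.X ^ k) x
  simp only [Polynomial.eval_pow, Polynomial.eval_X] at h
  refine h.congr_deriv ?_
  unfold invPowGlue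
  rcases k with _ | k
  · simp
  · simp
    ring

theorem invPowGlue_of_nonpos (k : ℕ) {x : ℝ} (hx : x ≤ 0) : invPowGlue k x = 0 := by
  simp [invPowGlue, expNegInvGlue.zero_of_nonpos hx]

theorem invPowGlue_nonneg (k : ℕ) (x : ℝ) : 0 ≤ invPowGlue k x := by
  rcases le_or_gt x 0 with hx | hx
  · rw [invPowGlue_of_nonpos k hx]
  · have := expNegInvGlue.nonneg x
    unfold invPowGlue
    positivity

theorem invPowGlue_le (k : ℕ) (x : ℝ) : invPowGlue k x ≤ Real.exp (-k) * (k : ℝ) ^ k := by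
  rcases le_or_gt x 0 with hx | hx
  · rw [invPowGlue_of_nonpos k hx]; positivity
  rw [invPowGlue, expNegInvGlue, if_neg hx.not_ge]
  have hu : 0 < x⁻¹ := inv_pos.2 hx
  generalize x⁻¹ = u at hu
  rcases Nat.eq_zero_or_pos k with rfl | hk
  · simpa using hu.le
  have hk' : (0 : ℝ) < k := by exact_mod_cast hk
  have h1 : u / k ≤ Real.exp (u / k - 1) := by
    have := Real.add_one_le_exp (u / k - 1)
    linarith
  have h2 : (u / k) ^ k ≤ Real.exp (u - k) := by
    calc (u / k) ^ k ≤ Real.exp (u / k - 1) ^ k := by gcongr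
      _ = Real.exp (u - k) := by
        rw [← Real.exp_nat_mul]; congr 1; field_simp
  rw [div_pow, div_le_iff₀ (by positivity)] at h2
  calc u ^ k * Real.exp (-u) ≤ Real.exp (u - k) * k ^ k * Real.exp (-u) := by gcongr
    _ = Real.exp (u - k + -u) * k ^ k := by rw [Real.exp_add]; ring
    _ = _ := by congr 2; ring

theorem invPowGlue_le_add_two (k : ℕ) {x : ℝ} (hx : x ≤ 1) :
    invPowGlue k x ≤ invPowGlue (k + 2) x := by
  rcases le_or_gt x 0 with h0 | h0
  · rw [invPowGlue_of_nonpos _ h0, invPowGlue_of_nonpos _ h0]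
  · rw [← mul_invPowGlue_succ, ← mul_invPowGlue_succ, ← mul_assoc]
    exact mul_le_of_le_one_left (invPowGlue_nonneg _ _) (mul_le_one₀ hx h0.le hx)

/-- The unnormalized standard mollifier. -/
noncomputable def bump (p : ℝ) : ℝ := expNegInvGlue (1 - p ^ 2)

theorem contDiff_bump : ContDiff ℝ (⊤ : ℕ∞) bump :=
  expNegInvGlue.contDiff.comp (contDiff_const.sub (contDiff_id.pow 2))

theorem bump_nonneg (p : ℝ) : 0 ≤ bump p := expNegInvGlue.nonneg _

theorem bump_eq_ite (p : ℝ) :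
    bump p = if |p| < 1 then Real.exp (1 / (p ^ 2 - 1)) else 0 := by
  unfold bump expNegInvGlue
  by_cases h : |p| < 1
  · have h2 : p ^ 2 < 1 := (sq_lt_one_iff_abs_lt_one p).2 h
    rw [if_neg (by linarith), if_pos h, ← inv_neg, neg_sub, one_div]
  · have h2 : ¬ p ^ 2 < 1 := fun h' => h ((sq_lt_one_iff_abs_lt_one p).1 h')
    rw [if_pos (by linarith), if_neg h]

open Polynomial in
/-- The polynomial factors of the derivatives of the bump function. -/
noncomputable def bumpPoly : ℕ → Polynomial ℝ
  | 0 => 1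
  | n + 1 => (1 - X ^ 2) ^ 2 * derivative (bumpPoly n) +
      (C (4 * n : ℝ) * X * (1 - X ^ 2) - C 2 * X) * bumpPoly n

theorem iteratedDeriv_bump (n : ℕ) :
    iteratedDeriv n bump =
      fun p => (bumpPoly n).eval p * invPowGlue (2 * n) (1 - p ^ 2) := by
  induction n with
  | zero => funext p; simp [bumpPoly, invPowGlue, bump]
  | succ n ih =>
    rw [iteratedDeriv_succ, ih]
    funext p
    have hin : HasDerivAt (fun p : ℝ => 1 - p ^ 2) (-(2 * p)) p := by
      simpa using (hasDerivAt_pow 2 p).const_sub 1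
    have h := ((bumpPoly n).hasDerivAt p).fun_mul
      ((hasDerivAt_invPowGlue (2 * n) (1 - p ^ 2)).comp p hin)
    refine h.deriv.trans ?_
    simp only [Function.comp, bumpPoly, Polynomial.eval_add, Polynomial.eval_mul,
      Polynomial.eval_sub, Polynomial.eval_pow, Polynomial.eval_X, Polynomial.eval_C,
      Polynomial.eval_one]
    rw [← mul_invPowGlue_succ (2 * n), ← mul_invPowGlue_succ (2 * n + 1),
      show 2 * (n + 1) = 2 * n + 1 + 1 by ring]
    push_cast
    ring

theorem natDegree_bumpPoly_le (n : ℕ) : (bumpPoly n).natDegree ≤ 3 * n := by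
  induction n with
  | zero => simp [bumpPoly]
  | succ n ih =>
    have hd := Polynomial.natDegree_derivative_le (bumpPoly n)
    rw [bumpPoly]
    refine Polynomial.natDegree_add_le_of_degree_le ?_ ?_
    · rcases Nat.eq_zero_or_pos n with rfl | hn
      · simp [bumpPoly]
      refine (Polynomial.natDegree_mul_le_of_le (m := 4) (n := 3 * n - 1) ?_ (by omega)).trans
        (by omega)
      compute_degree
    · refine (Polynomial.natDegree_mul_le_of_le (m := 3) ?_ ih).trans (by omega)
      compute_degree

theorem coeffL1_bumpPoly_le (n : ℕ) : (bumpPoly n).coeffL1 ≤ 20 ^ n * (n.factorial : ℝ) := by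
  induction n with
  | zero =>
    have := Polynomial.coeffL1_monomial 0 1
    simpa [bumpPoly] using this.le
  | succ n ih =>
    have hq : (1 - Polynomial.X ^ 2 : Polynomial ℝ).coeffL1 ≤ 2 := by
      have := Polynomial.coeffL1_add_le (Polynomial.monomial 0 1) (Polynomial.monomial 2 (-1))
      rw [Polynomial.coeffL1_monomial, Polynomial.coeffL1_monomial] at this
      rw [show (1 - Polynomial.X ^ 2 : Polynomial ℝ)
        = Polynomial.monomial 0 1 + Polynomial.monomial 2 (-1) by
          simp [← Polynomial.C_mul_X_pow_eq_monomial, sub_eq_add_neg]]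
      norm_num at this ⊢
      exact this
    have hX (c : ℝ) : (Polynomial.C c * Polynomial.X).coeffL1 = |c| := by
      rw [← pow_one Polynomial.X, Polynomial.C_mul_X_pow_eq_monomial,
        Polynomial.coeffL1_monomial]
    have hq2 : ((1 - Polynomial.X ^ 2 : Polynomial ℝ) ^ 2).coeffL1 ≤ 4 := by
      rw [sq (1 - _)]
      refine (Polynomial.coeffL1_mul_le _ _).trans ?_
      nlinarith [Polynomial.coeffL1_nonneg (1 - Polynomial.X ^ 2)]
    have hd : (Polynomial.derivative (bumpPoly n)).coeffL1 ≤ 3 * n * (bumpPoly n).coeffL1 := by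
      refine (Polynomial.coeffL1_derivative_le _).trans ?_
      have := Polynomial.coeffL1_nonneg (bumpPoly n)
      gcongr
      exact_mod_cast natDegree_bumpPoly_le n
    have hl : (Polynomial.C (4 * n : ℝ) * Polynomial.X * (1 - Polynomial.X ^ 2)
        - Polynomial.C 2 * Polynomial.X : Polynomial ℝ).coeffL1 ≤ 8 * n + 2 := by
      rw [sub_eq_add_neg, ← neg_mul, ← Polynomial.C_neg]
      refine (Polynomial.coeffL1_add_le _ _).trans ?_
      rw [hX, abs_neg, abs_two]
      gcongr
      refine (Polynomial.coeffL1_mul_le _ _).trans ?_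
      rw [hX, abs_of_nonneg (by positivity)]
      nlinarith [(Nat.cast_nonneg n : (0 : ℝ) ≤ n)]
    have h0 := Polynomial.coeffL1_nonneg (bumpPoly n)
    calc (bumpPoly (n + 1)).coeffL1
        ≤ 4 * (3 * n * (bumpPoly n).coeffL1) + (8 * n + 2) * (bumpPoly n).coeffL1 := by
          rw [bumpPoly]
          refine (Polynomial.coeffL1_add_le _ _).trans (add_le_add ?_ ?_)
          · refine (Polynomial.coeffL1_mul_le _ _).trans ?_
            exact mul_le_mul hq2 hd (Polynomial.coeffL1_nonneg _) (by norm_num)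
          · refine (Polynomial.coeffL1_mul_le _ _).trans ?_
            gcongr
      _ ≤ 20 * (n + 1) * (bumpPoly n).coeffL1 := by nlinarith
      _ ≤ 20 * (n + 1) * (20 ^ n * (n.factorial : ℝ)) := by gcongr
      _ = _ := by rw [Nat.factorial_succ]; push_cast; ring

theorem abs_iteratedDeriv_bump_le (n : ℕ) (p : ℝ) :
    |iteratedDeriv n bump p| ≤ 20 ^ n * (n.factorial : ℝ) * invPowGlue (2 * n) (1 - p ^ 2) := by
  rw [iteratedDeriv_bump]
  rcases le_or_gt (1 - p ^ 2) 0 with h | h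
  · simp [invPowGlue_of_nonpos _ h]
  · have hp : |p| ≤ 1 := (sq_le_one_iff_abs_le_one p).1 (by linarith)
    simp only [abs_mul, abs_of_nonneg (invPowGlue_nonneg _ _)]
    exact mul_le_mul_of_nonneg_right
      (((bumpPoly n).abs_eval_le_coeffL1 hp).trans (coeffL1_bumpPoly_le n))
      (invPowGlue_nonneg _ _)

theorem abs_iteratedDeriv_bump_le_succ (n : ℕ) (p : ℝ) :
    |iteratedDeriv n bump p| ≤ 20 ^ (n + 1) * ((n + 1).factorial : ℝ) *
      Real.exp (-(2 * ((n + 1 : ℕ) : ℝ))) * (2 * ((n + 1 : ℕ) : ℝ)) ^ (2 * (n + 1)) := by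
  refine (abs_iteratedDeriv_bump_le n p).trans ?_
  have h1 := (invPowGlue_le_add_two (2 * n) (x := 1 - p ^ 2) (by nlinarith [sq_nonneg p])).trans
    (invPowGlue_le (2 * n + 2) (1 - p ^ 2))
  rw [mul_assoc (20 ^ (n + 1) * _)]
  refine mul_le_mul (mul_le_mul ?_ ?_ (by positivity) (by positivity)) ?_
    (invPowGlue_nonneg _ _) (by positivity)
  · exact pow_le_pow_right₀ (by norm_num) n.le_succ
  · exact_mod_cast Nat.factorial_le n.le_succ
  · refine h1.trans_eq ?_
    rw [show 2 * n + 2 = 2 * (n + 1) by ring]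
    push_cast
    rfl

theorem bump_eq_zero_of_one_le_abs {p : ℝ} (hp : 1 ≤ |p|) : bump p = 0 := by
  rw [bump_eq_ite, if_neg hp.not_gt]

theorem hasCompactSupport_bump : HasCompactSupport bump :=
  HasCompactSupport.intro (isCompact_Icc (a := (-1 : ℝ)) (b := 1)) fun _ hp =>
    bump_eq_zero_of_one_le_abs (le_of_not_ge fun h => hp (abs_le.1 h))

theorem mollC_eq_integral_bump : mollC = ∫ p, bump p := by
  have h : ∀ p ∉ Set.Ioo (-1 : ℝ) 1, bump p = 0 := fun p hp =>
    bump_eq_zero_of_one_le_abs (le_of_not_gt fun h => hp (abs_lt.1 h))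
  rw [mollC, intervalIntegral.integral_of_le (by norm_num),
    MeasureTheory.integral_Ioc_eq_integral_Ioo,
    ← MeasureTheory.setIntegral_eq_integral_of_forall_compl_eq_zero h]
  refine MeasureTheory.setIntegral_congr_fun measurableSet_Ioo fun p hp => ?_
  rw [bump_eq_ite, if_pos (abs_lt.2 hp)]

theorem mollC_pos : 0 < mollC := by
  rw [mollC_eq_integral_bump]
  refine contDiff_bump.continuous.integral_pos_of_hasCompactSupport_nonneg_nonzero
    hasCompactSupport_bump bump_nonneg (x := 0) ?_
  simp [bump]

theorem η_eq : η = fun p => mollC⁻¹ * bump p := by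
  funext p
  rw [η, bump_eq_ite, mul_ite, mul_zero]

theorem contDiff_η : ContDiff ℝ (⊤ : ℕ∞) η := by
  rw [η_eq]; exact contDiff_const.mul contDiff_bump

theorem η_nonneg (p : ℝ) : 0 ≤ η p := by
  rw [η_eq]; exact mul_nonneg (inv_nonneg.2 mollC_pos.le) (bump_nonneg p)

theorem integrable_η : MeasureTheory.Integrable η := by
  rw [η_eq]
  exact (contDiff_bump.continuous.integrable_of_hasCompactSupport
    hasCompactSupport_bump).const_mul _

theorem integral_η : ∫ p, η p = 1 := by
  rw [η_eq, MeasureTheory.integral_const_mul, ← mollC_eq_integral_bump,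
    inv_mul_cancel₀ mollC_pos.ne']

theorem abs_iteratedDeriv_η_le (n : ℕ) (p : ℝ) :
    |iteratedDeriv n η p| ≤ mollC⁻¹ * (20 ^ (n + 1) * ((n + 1).factorial : ℝ) *
      Real.exp (-(2 * ((n + 1 : ℕ) : ℝ))) * (2 * ((n + 1 : ℕ) : ℝ)) ^ (2 * (n + 1))) := by
  rw [η_eq, iteratedDeriv_const_mul_field, abs_mul, abs_of_pos (inv_pos.2 mollC_pos)]
  exact mul_le_mul_of_nonneg_left (abs_iteratedDeriv_bump_le_succ n p) (inv_pos.2 mollC_pos).le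

theorem integral_mollifier_mul_indicator {a b : ℝ} (d : ℝ) (hab : a ≤ b) (p : ℝ) :
    ∫ y : ℝ, d⁻¹ * η ((p - y) / d) * Set.indicator (Set.Icc a b) (fun _ => (1 : ℝ)) y =
      ∫ x in ((p - b) / d)..((p - a) / d), η x := by
  have h (y : ℝ) : d⁻¹ * η ((p - y) / d) * Set.indicator (Set.Icc a b) (fun _ => (1 : ℝ)) y =
      Set.indicator (Set.Icc a b) (fun y => d⁻¹ * η (p / d - y / d)) y := by
    by_cases hy : y ∈ Set.Icc a b <;> simp [hy, sub_div]
  simp_rw [h]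
  rw [MeasureTheory.integral_indicator measurableSet_Icc,
    MeasureTheory.integral_Icc_eq_integral_Ioc, ← intervalIntegral.integral_of_le hab,
    intervalIntegral.integral_const_mul, intervalIntegral.inv_mul_integral_comp_sub_div,
    sub_div, sub_div]

theorem hasDerivAt_integral_η (d a b p : ℝ) :
    HasDerivAt (fun p => ∫ x in ((p - b) / d)..((p - a) / d), η x)
      (d⁻¹ * (η (d⁻¹ * (p - a)) - η (d⁻¹ * (p - b)))) p := by
  have hc := contDiff_η.continuous
  have hG (x : ℝ) : HasDerivAt (fun x => ∫ t in (0 : ℝ)..x, η t) (η x) x :=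
    intervalIntegral.integral_hasDerivAt_right (hc.intervalIntegrable _ _)
      (hc.stronglyMeasurableAtFilter _ _) hc.continuousAt
  have hl (c : ℝ) : HasDerivAt (fun p : ℝ => (p - c) / d) (1 / d) p :=
    ((hasDerivAt_id p).sub_const c).div_const d
  have h := ((hG _).comp p (hl a)).fun_sub ((hG _).comp p (hl b))
  have he : (fun p => ∫ x in ((p - b) / d)..((p - a) / d), η x) = fun p =>
      ((fun x => ∫ t in (0 : ℝ)..x, η t) ∘ fun p => (p - a) / d) p -
        ((fun x => ∫ t in (0 : ℝ)..x, η t) ∘ fun p => (p - b) / d) p := by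
    funext p
    exact (intervalIntegral.integral_interval_sub_left (hc.intervalIntegrable _ _)
      (hc.intervalIntegrable _ _)).symm
  rw [he]
  refine h.congr_deriv ?_
  simp only [div_eq_inv_mul]
  ring

theorem contDiff_η_comp (c a : ℝ) : ContDiff ℝ (⊤ : ℕ∞) fun p => η (c * (p - a)) :=
  contDiff_η.comp (contDiff_const.mul (contDiff_id.sub contDiff_const))

theorem iteratedDeriv_η_comp (n : ℕ) (c a p : ℝ) :
    iteratedDeriv n (fun p => η (c * (p - a))) p = c ^ n * iteratedDeriv n η (c * (p - a)) := by
  rw [iteratedDeriv_comp_sub_const n (fun x => η (c * x)) a,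
    iteratedDeriv_comp_const_mul (contDiff_η.of_le (by exact_mod_cast le_top)) c]

theorem stmt4 (d : ℝ) (hd : 0 < d) (a b : ℝ) (ζ : ℝ → ℝ)
    (hζ : ζ = fun p => ∫ y : ℝ,
        d⁻¹ * η ((p - y) / d) * Set.indicator (Set.Icc a b) (fun _ => (1 : ℝ)) y) :
    ContDiff ℝ (⊤ : ℕ∞) ζ ∧ (∀ p : ℝ, 0 ≤ ζ p ∧ ζ p ≤ 1) ∧
      ∀ k : ℕ, 1 ≤ k → ∀ p : ℝ,
        |iteratedDeriv k ζ p| ≤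
          2 / mollC * 20 ^ k * (Nat.factorial k : ℝ) * Real.exp (-(2 * (k : ℝ))) *
            (2 * (k : ℝ)) ^ (2 * k) / d ^ k := by
  have hC := mollC_pos
  rcases lt_or_ge b a with hab | hab
  · have h0 : ζ = fun _ => 0 := by
      rw [hζ]
      funext p
      simp [Set.Icc_eq_empty_of_lt hab]
    subst h0
    refine ⟨contDiff_const, fun p => by simp, fun k _ p => ?_⟩
    rw [iteratedDeriv_fun_const_zero, abs_zero]
    positivity
  have hζ' : ζ = fun p => ∫ x in ((p - b) / d)..((p - a) / d), η x := by
    rw [hζ]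
    funext p
    exact integral_mollifier_mul_indicator d hab p
  have hder (p : ℝ) : HasDerivAt ζ (d⁻¹ * (η (d⁻¹ * (p - a)) - η (d⁻¹ * (p - b)))) p := by
    rw [hζ']; exact hasDerivAt_integral_η d a b p
  have hderiv : deriv ζ = fun p => d⁻¹ * (η (d⁻¹ * (p - a)) - η (d⁻¹ * (p - b))) :=
    funext fun p => (hder p).deriv
  refine ⟨?_, fun p => ?_, fun k hk p => ?_⟩
  · refine contDiff_infty_iff_deriv.2 ⟨fun p => (hder p).differentiableAt, ?_⟩
    rw [hderiv]
    exact contDiff_const.mul ((contDiff_η_comp _ _).sub (contDiff_η_comp _ _))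
  · have hle : (p - b) / d ≤ (p - a) / d := by gcongr
    rw [hζ']
    refine ⟨intervalIntegral.integral_nonneg hle fun x _ => η_nonneg x, ?_⟩
    rw [← integral_η]
    simp only [intervalIntegral.integral_of_le hle]
    exact MeasureTheory.setIntegral_le_integral integrable_η (.of_forall η_nonneg)
  · obtain ⟨n, rfl⟩ := Nat.exists_eq_add_of_le' hk
    have hs (c : ℝ) : ContDiffAt ℝ n (fun p => η (d⁻¹ * (p - c))) p :=
      ((contDiff_η_comp d⁻¹ c).of_le (by exact_mod_cast le_top)).contDiffAt
    rw [iteratedDeriv_succ', hderiv, iteratedDeriv_const_mul_field,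
      iteratedDeriv_fun_sub (hs a) (hs b), iteratedDeriv_η_comp, iteratedDeriv_η_comp,
      ← mul_sub, ← mul_assoc, ← pow_succ', abs_mul, abs_of_pos (by positivity)]
    have h := (abs_sub _ _).trans (add_le_add (abs_iteratedDeriv_η_le n (d⁻¹ * (p - a)))
      (abs_iteratedDeriv_η_le n (d⁻¹ * (p - b))))
    refine (mul_le_mul_of_nonneg_left h (by positivity)).trans_eq ?_
    rw [inv_pow]
    ring
end

section
/- There exists a constant C₀ > 0 with the following property. Let r ≥ 1 be an integer, set d = r, and let ζ : ℝ → ℝ be a C^∞ function such that 0 ≤ ζ ≤ 1, ζ is supported in [-(1+2d), R+2d] for some fixed R > 0, and |ζ^{(k)}(p)| ≤ 20^k · k! · e^{-2k} · (2k)^{2k} / d^k for all 0 ≤ k ≤ r and all p ∈ ℝ. Then the function ψ(p) = ζ(p) e^{-p} satisfies ‖ψ^{(r)}‖_{L²(ℝ)} ≤ (C₀ r²)^r; equivalently, ‖ψ^{(r)}‖_{L²(ℝ)}^{1/r} ≤ C₀ r². -/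
open MeasureTheory

/-- A function supported in `[a, ∞)` and dominated there by `M * exp (-x)` has `L²` norm at most
`M * exp (-a)`. -/
theorem eLpNorm_two_le_of_abs_le_exp_neg {f : ℝ → ℝ} {a M : ℝ} (hM : 0 ≤ M)
    (hzero : ∀ x < a, f x = 0) (hbound : ∀ x, |f x| ≤ M * Real.exp (-x)) :
    eLpNorm f 2 volume ≤ ENNReal.ofReal (M * Real.exp (-a)) := by
  have hint : IntegrableOn (fun x : ℝ => M ^ 2 * Real.exp (-2 * x)) (Set.Ioi a) :=
    (integrableOn_exp_mul_Ioi (by norm_num) a).const_mul _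
  have hlint : ∫⁻ x, ‖f x‖ₑ ^ (2 : ℝ) ≤ ENNReal.ofReal (M * Real.exp (-a)) ^ (2 : ℝ) := by
    calc ∫⁻ x, ‖f x‖ₑ ^ (2 : ℝ)
        ≤ ∫⁻ x, (Set.Ici a).indicator
            (fun x => ENNReal.ofReal (M ^ 2 * Real.exp (-2 * x))) x := by
          refine lintegral_mono fun x => ?_
          rcases lt_or_ge x a with hx | hx
          · simp [hzero x hx]
          · rw [Set.indicator_of_mem (Set.mem_Ici.mpr hx), Real.enorm_eq_ofReal_abs,
              ENNReal.ofReal_rpow_of_nonneg (abs_nonneg _) (by norm_num), Real.rpow_two]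
            refine ENNReal.ofReal_le_ofReal ?_
            calc |f x| ^ 2 ≤ (M * Real.exp (-x)) ^ 2 := by gcongr; exact hbound x
              _ = M ^ 2 * Real.exp (-2 * x) := by
                rw [mul_pow, ← Real.exp_nat_mul]; push_cast; ring_nf
      _ = ∫⁻ x in Set.Ioi a, ENNReal.ofReal (M ^ 2 * Real.exp (-2 * x)) := by
          rw [lintegral_indicator measurableSet_Ici, restrict_Ioi_eq_restrict_Ici]
      _ = ENNReal.ofReal (M ^ 2 * (-Real.exp (-2 * a) / -2)) := by
          rw [← ofReal_integral_eq_lintegral_ofReal hint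
            (Filter.Eventually.of_forall fun x => by positivity), integral_const_mul,
            integral_exp_mul_Ioi (by norm_num)]
      _ ≤ ENNReal.ofReal (M * Real.exp (-a)) ^ (2 : ℝ) := by
          rw [ENNReal.ofReal_rpow_of_nonneg (by positivity) (by norm_num), Real.rpow_two,
            mul_pow, ← Real.exp_nat_mul]
          refine ENNReal.ofReal_le_ofReal ?_
          push_cast
          rw [show (2 : ℝ) * -a = -2 * a by ring]
          gcongr
          linarith [Real.exp_pos (-2 * a)]
  rw [eLpNorm_eq_lintegral_rpow_enorm_toReal (by norm_num) (by norm_num), ENNReal.toReal_ofNat]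
  calc (∫⁻ x, ‖f x‖ₑ ^ (2 : ℝ)) ^ (1 / (2 : ℝ))
      ≤ (ENNReal.ofReal (M * Real.exp (-a)) ^ (2 : ℝ)) ^ (1 / (2 : ℝ)) := by gcongr
    _ = ENNReal.ofReal (M * Real.exp (-a)) := by rw [← ENNReal.rpow_mul]; norm_num

/-- If the derivatives of `ζ` up to order `r` grow at most geometrically, then the `r`-th
derivative of `ζ p * exp (-p)` is bounded through the binomial formula. -/
theorem abs_iteratedDeriv_mul_exp_neg_le {ζ : ℝ → ℝ} {r : ℕ} {p B : ℝ}
    (hζ : ContDiffAt ℝ r ζ p) (hB : ∀ k ≤ r, |iteratedDeriv k ζ p| ≤ B ^ k) :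
    |iteratedDeriv r (fun p => ζ p * Real.exp (-p)) p| ≤ (B + 1) ^ r * Real.exp (-p) := by
  have hexp (k : ℕ) :
      iteratedDeriv k (fun p => Real.exp (-p)) p = (-1) ^ k * Real.exp (-p) := by
    simpa using congrFun (iteratedDeriv_exp_const_mul k (-1)) p
  have hleib := iteratedDeriv_mul hζ
    (g := fun p => Real.exp (-p)) (Real.contDiff_exp.comp contDiff_neg).contDiffAt
  change |iteratedDeriv r (ζ * fun p => Real.exp (-p)) p| ≤ _
  rw [hleib, add_pow, Finset.sum_mul]
  refine (Finset.abs_sum_le_sum_abs _ _).trans (Finset.sum_le_sum fun k hk => ?_)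
  have hk' := hB k (Nat.lt_succ_iff.mp (Finset.mem_range.mp hk))
  rw [hexp, abs_mul, abs_mul, abs_mul, abs_pow, abs_neg, abs_one, one_pow, one_mul,
    mul_one, Real.abs_exp, Nat.abs_cast, mul_comm (r.choose k : ℝ)]
  gcongr

theorem mollifier_bound_le {r k : ℕ} (hr : 1 ≤ r) (hk : k ≤ r) :
    20 ^ k * (Nat.factorial k : ℝ) * Real.exp (-(2 * (k : ℝ))) *
      (2 * (k : ℝ)) ^ (2 * k) / (r : ℝ) ^ k ≤ (80 * (r : ℝ) ^ 2) ^ k := by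
  have hr0 : (0 : ℝ) < r := by exact_mod_cast hr
  have hkr : (k : ℝ) ≤ r := by exact_mod_cast hk
  have hfac : (Nat.factorial k : ℝ) ≤ (r : ℝ) ^ k := by
    exact_mod_cast (Nat.factorial_le_pow k).trans (Nat.pow_le_pow_left hk k)
  have hexp : Real.exp (-(2 * (k : ℝ))) ≤ 1 := Real.exp_le_one_iff.mpr (by simp)
  rw [div_le_iff₀ (by positivity)]
  calc 20 ^ k * (Nat.factorial k : ℝ) * Real.exp (-(2 * (k : ℝ))) * (2 * (k : ℝ)) ^ (2 * k)
      ≤ 20 ^ k * (r : ℝ) ^ k * 1 * (2 * (r : ℝ)) ^ (2 * k) := by gcongr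
    _ = (80 * (r : ℝ) ^ 2) ^ k * (r : ℝ) ^ k := by
      rw [mul_one, pow_mul, ← mul_pow, ← mul_pow, ← mul_pow]; ring

theorem stmt5 :
    ∃ C₀ : ℝ, 0 < C₀ ∧
      ∀ (r : ℕ), 1 ≤ r → ∀ (R : ℝ), 0 < R → ∀ ζ : ℝ → ℝ,
        ContDiff ℝ (⊤ : ℕ∞) ζ →
        (∀ p : ℝ, 0 ≤ ζ p ∧ ζ p ≤ 1) →
        Function.support ζ ⊆ Set.Icc (-(1 + 2 * (r : ℝ))) (R + 2 * (r : ℝ)) →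
        (∀ k : ℕ, k ≤ r → ∀ p : ℝ,
          |iteratedDeriv k ζ p| ≤
            20 ^ k * (Nat.factorial k : ℝ) * Real.exp (-(2 * (k : ℝ))) *
              (2 * (k : ℝ)) ^ (2 * k) / (r : ℝ) ^ k) →
        eLpNorm (iteratedDeriv r (fun p : ℝ => ζ p * Real.exp (-p))) 2 volume ≤
          ENNReal.ofReal ((C₀ * (r : ℝ) ^ 2) ^ r) := by
  refine ⟨81 * Real.exp 3, by positivity, fun r hr R _ ζ hζ _ hsupp hbound => ?_⟩
  have hr1 : (1 : ℝ) ≤ r := by exact_mod_cast hr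
  have hzero : ∀ x < -(1 + 2 * (r : ℝ)),
      iteratedDeriv r (fun p : ℝ => ζ p * Real.exp (-p)) x = 0 := by
    intro x hx
    have hev : (fun p : ℝ => ζ p * Real.exp (-p)) =ᶠ[nhds x] fun _ => 0 := by
      filter_upwards [Iio_mem_nhds hx] with y hy
      have : ζ y = 0 := by
        by_contra h
        exact (hsupp h).1.not_gt hy
      simp [this]
    simpa [iteratedDeriv_const] using (hev.iteratedDeriv r).eq_of_nhds
  refine (eLpNorm_two_le_of_abs_le_exp_neg (M := (80 * (r : ℝ) ^ 2 + 1) ^ r) (by positivity)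
    hzero fun p => abs_iteratedDeriv_mul_exp_neg_le
      (hζ.contDiffAt.of_le (by exact_mod_cast le_top))
      fun k hk => (hbound k hk p).trans (mollifier_bound_le hr hk)).trans ?_
  refine ENNReal.ofReal_le_ofReal ?_
  calc (80 * (r : ℝ) ^ 2 + 1) ^ r * Real.exp (- -(1 + 2 * (r : ℝ)))
      ≤ (81 * (r : ℝ) ^ 2) ^ r * Real.exp (r * 3) := by
        gcongr
        · nlinarith
        · linarith
    _ = (81 * Real.exp 3 * (r : ℝ) ^ 2) ^ r := by
        rw [Real.exp_nat_mul, ← mul_pow]; ring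
end

section
/- Let a ≥ 2 and define ψ(p) = ((erf(a p) + 1)/2) · e^{-p}. Then for all p ∈ ℝ, 0 ≤ ψ(p) ≤ 2 e^{-|p|}. -/
/-- The error function `erf(x) = (2/√π) ∫_0^x e^{-t²} dt`. -/
noncomputable def erf (x : ℝ) : ℝ :=
  (2 / Real.sqrt Real.pi) * ∫ t in (0 : ℝ)..x, Real.exp (-t ^ 2)

theorem integrable_exp_neg_sq : MeasureTheory.Integrable fun t : ℝ => Real.exp (-t ^ 2) := by
  simpa using integrable_exp_neg_mul_sq (b := 1) one_pos

theorem integral_Iic_zero_exp_neg_sq :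
    ∫ t in Set.Iic (0 : ℝ), Real.exp (-t ^ 2) = √Real.pi / 2 := by
  have h := integral_gaussian_Ioi 1
  have h' := integral_comp_neg_Iic (0 : ℝ) fun t : ℝ => Real.exp (-t ^ 2)
  simp only [neg_sq, neg_zero] at h'
  simpa [h'] using h

/-- The shifted error function is a normalized Gaussian lower tail. -/
theorem erf_add_one_div_two (x : ℝ) :
    (erf x + 1) / 2 = (√Real.pi)⁻¹ * ∫ t in Set.Iic x, Real.exp (-t ^ 2) := by
  have h := intervalIntegral.integral_Iic_sub_Iic
    (integrable_exp_neg_sq.integrableOn (s := Set.Iic 0))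
    (integrable_exp_neg_sq.integrableOn (s := Set.Iic x))
  rw [integral_Iic_zero_exp_neg_sq] at h
  have hpi : √Real.pi ≠ 0 := (Real.sqrt_pos.2 Real.pi_pos).ne'
  rw [erf, ← h]
  field_simp
  ring

theorem erf_add_one_div_two_nonneg (x : ℝ) : 0 ≤ (erf x + 1) / 2 := by
  rw [erf_add_one_div_two]
  exact mul_nonneg (by positivity)
    (MeasureTheory.integral_nonneg fun t => (Real.exp_pos _).le)

theorem erf_add_one_div_two_le_one (x : ℝ) : (erf x + 1) / 2 ≤ 1 := by
  have hpi : 0 < √Real.pi := Real.sqrt_pos.2 Real.pi_pos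
  have h : ∫ t in Set.Iic x, Real.exp (-t ^ 2) ≤ ∫ t : ℝ, Real.exp (-t ^ 2) :=
    MeasureTheory.setIntegral_le_integral integrable_exp_neg_sq
      (Filter.Eventually.of_forall fun t => (Real.exp_pos _).le)
  have hint : ∫ t : ℝ, Real.exp (-t ^ 2) = √Real.pi := by
    simpa using integral_gaussian 1
  rw [erf_add_one_div_two, inv_mul_le_iff₀ hpi, mul_one]
  exact h.trans_eq hint

theorem erf_add_one_div_two_le_two_mul_exp (x : ℝ) : (erf x + 1) / 2 ≤ 2 * Real.exp x := by
  have hpi : 0 < √Real.pi := Real.sqrt_pos.2 Real.pi_pos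
  have h : ∫ t in Set.Iic x, Real.exp (-t ^ 2) ≤
      ∫ t in Set.Iic x, Real.exp (1 / 4) * Real.exp t := by
    refine MeasureTheory.setIntegral_mono integrable_exp_neg_sq.integrableOn
      ((integrableOn_exp_Iic x).const_mul _) fun t => ?_
    rw [← Real.exp_add]
    exact Real.exp_le_exp.2 (by nlinarith [sq_nonneg (t + 1 / 2)])
  rw [MeasureTheory.integral_const_mul, integral_exp_Iic] at h
  have hexp : Real.exp (1 / 4) ≤ √Real.pi * 2 := by
    have h₁ : Real.exp (1 / 4) ≤ Real.exp 1 := Real.exp_le_exp.2 (by norm_num)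
    have h₂ : (3 / 2 : ℝ) ≤ √Real.pi :=
      Real.le_sqrt_of_sq_le (by linarith [Real.pi_gt_three])
    linarith [Real.exp_one_lt_d9]
  rw [erf_add_one_div_two, inv_mul_le_iff₀ hpi, ← mul_assoc]
  exact h.trans (by gcongr)

theorem stmt9 (a : ℝ) (ha : 2 ≤ a) (p : ℝ) :
    0 ≤ (erf (a * p) + 1) / 2 * Real.exp (-p) ∧
      (erf (a * p) + 1) / 2 * Real.exp (-p) ≤ 2 * Real.exp (-|p|) := by
  refine ⟨mul_nonneg (erf_add_one_div_two_nonneg _) (Real.exp_pos _).le, ?_⟩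
  rcases le_total 0 p with hp | hp
  · rw [abs_of_nonneg hp]
    gcongr
    linarith [erf_add_one_div_two_le_one (a * p)]
  · rw [abs_of_nonpos hp, neg_neg]
    calc (erf (a * p) + 1) / 2 * Real.exp (-p)
        ≤ 2 * Real.exp (a * p) * Real.exp (-p) := by
          gcongr
          exact erf_add_one_div_two_le_two_mul_exp _
      _ = 2 * Real.exp (a * p + -p) := by rw [mul_assoc, ← Real.exp_add]
      _ ≤ 2 * Real.exp p := by
          gcongr
          nlinarith
end
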